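/- Let κ > 0 be the normalizing constant making ρ(x) = κ e^{−1/|x|} χ_{(−1,1)}(x) a probability density, let F be the associated cumulative distribution function and q the quantile function. Then F(x) ≤ 1/2 + κ e^{−1/x} for all x ∈ (0,1) and F(x) ≥ 1/2 − κ e^{1/x} for all x ∈ (−1,0); consequently q(u) ≥ −1/ln((u − 1/2)/κ) for u ∈ (1/2, 1) with (u−1/2)/κ < 1, and q(u) ≤ 1/ln((1/2 − u)/κ) for u ∈ (0, 1/2) with (1/2−u)/κ < 1. -/

import Mathlib

open MeasureTheory Filter Set
open scoped Real

/-- The cumulative distribution function of a measure `μ` on `ℝ`: `F(x) = μ((−∞, x])`. -/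
noncomputable def cdfFn (μ : Measure ℝ) (x : ℝ) : ℝ := (μ (Iic x)).toReal

/-- The quantile function of `μ`: `q(u) = inf {x | F(x) ≥ u}`. -/
noncomputable def quantileFn (μ : Measure ℝ) (u : ℝ) : ℝ := sInf {x : ℝ | u ≤ cdfFn μ x}

/-- The density `κ e^{−1/|x|}` restricted to `(−1,1)`. -/
noncomputable def flatDensity (κ x : ℝ) : ENNReal :=
  ENNReal.ofReal (if x ∈ Ioo (-1 : ℝ) 1 then κ * Real.exp (-1 / |x|) else 0)

lemma flatDensity_neg (κ x : ℝ) : flatDensity κ (-x) = flatDensity κ x := by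
  have h : -x ∈ Ioo (-1 : ℝ) 1 ↔ x ∈ Ioo (-1 : ℝ) 1 := by
    simp only [mem_Ioo]; constructor <;> rintro ⟨_, _⟩ <;> constructor <;> linarith
  simp only [flatDensity, h, abs_neg]

lemma withDensity_flatDensity_neg (κ : ℝ) {s : Set ℝ} (hs : MeasurableSet s) :
    volume.withDensity (flatDensity κ) (-s) = volume.withDensity (flatDensity κ) s := by
  rw [withDensity_apply _ hs.neg, withDensity_apply _ hs, ← lintegral_indicator hs.neg,
    ← lintegral_indicator hs, ← lintegral_neg_eq_self]
  refine lintegral_congr fun x => ?_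
  have h : -x ∈ -s ↔ x ∈ s := Set.neg_mem_neg
  by_cases hx : x ∈ s
  · rw [indicator_of_mem hx, indicator_of_mem (h.2 hx), flatDensity_neg]
  · rw [indicator_of_notMem hx, indicator_of_notMem (mt h.1 hx)]

lemma withDensity_flatDensity_Ioi_one (κ : ℝ) :
    volume.withDensity (flatDensity κ) (Ioi 1) = 0 := by
  rw [withDensity_apply _ measurableSet_Ioi,
    setLIntegral_congr_fun (g := fun _ => 0) measurableSet_Ioi, lintegral_zero]
  intro x hx
  have : ¬ x < 1 := not_lt.2 (le_of_lt hx)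
  simp [flatDensity, this]

lemma withDensity_flatDensity_Ioc_zero_le {κ : ℝ} (hκ : 0 < κ) {x : ℝ}
    (hx1 : x ≤ 1) :
    volume.withDensity (flatDensity κ) (Ioc 0 x) ≤ ENNReal.ofReal (κ * Real.exp (-1 / x)) := by
  rw [withDensity_apply _ measurableSet_Ioc]
  calc ∫⁻ t in Ioc 0 x, flatDensity κ t
      ≤ ∫⁻ _ in Ioc 0 x, ENNReal.ofReal (κ * Real.exp (-1 / x)) := by
        refine setLIntegral_mono measurable_const fun t ht => ?_
        refine ENNReal.ofReal_le_ofReal ?_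
        split_ifs
        · have h : 1 / x ≤ 1 / t := one_div_le_one_div_of_le ht.1 ht.2
          rw [abs_of_pos ht.1, neg_div, neg_div]
          gcongr
        · positivity
    _ = ENNReal.ofReal (κ * Real.exp (-1 / x)) * ENNReal.ofReal x := by simp
    _ ≤ _ := mul_le_of_le_one_right' (ENNReal.ofReal_le_one.2 hx1)

section FlatMeasure

variable {κ : ℝ} {μ : Measure ℝ}

lemma real_Ioc_zero_le_of_flatDensity (hκ : 0 < κ)
    (hdens : μ = volume.withDensity (flatDensity κ)) {x : ℝ} (hx1 : x ≤ 1) :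
    μ.real (Ioc 0 x) ≤ κ * Real.exp (-1 / x) := by
  have h := withDensity_flatDensity_Ioc_zero_le hκ hx1
  rw [← hdens] at h
  exact ENNReal.toReal_le_of_le_ofReal (by positivity) h

lemma cdfFn_eq_zero_of_flatDensity (hdens : μ = volume.withDensity (flatDensity κ)) {x : ℝ}
    (hx : x < -1) : cdfFn μ x = 0 := by
  have h := withDensity_flatDensity_neg κ (measurableSet_Ioi (a := (1 : ℝ)))
  rw [withDensity_flatDensity_Ioi_one, ← hdens, Set.neg_Ioi] at h
  simp [cdfFn, measure_mono_null (Iic_subset_Iio.2 hx) h]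

variable [IsProbabilityMeasure μ]

lemma real_Iic_zero_of_flatDensity (hdens : μ = volume.withDensity (flatDensity κ)) :
    μ.real (Iic 0) = 1 / 2 := by
  have hneg : μ.real (Ioi 0) = μ.real (Iio 0) := by
    have h := withDensity_flatDensity_neg κ (measurableSet_Iio (a := (0 : ℝ)))
    rw [← hdens] at h
    simpa [measureReal_def] using congrArg ENNReal.toReal h
  have hac : μ ≪ volume := hdens ▸ withDensity_absolutelyContinuous _ _
  have hiic : μ.real (Iic 0) = μ.real (Iio 0) :=
    measureReal_congr (hac.ae_eq Iio_ae_eq_Iic.symm)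
  have hcompl := probReal_compl_eq_one_sub (μ := μ) (measurableSet_Iic (a := (0 : ℝ)))
  rw [compl_Iic] at hcompl
  linarith

lemma cdfFn_mono : Monotone (cdfFn μ) := fun _ _ h => measureReal_mono (Iic_subset_Iic.2 h)

lemma cdfFn_le_of_flatDensity (hκ : 0 < κ) (hdens : μ = volume.withDensity (flatDensity κ))
    {x : ℝ} (hx : 0 < x) (hx1 : x ≤ 1) : cdfFn μ x ≤ 1 / 2 + κ * Real.exp (-1 / x) := by
  have h : cdfFn μ x ≤ μ.real (Iic 0) + μ.real (Ioc 0 x) := by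
    rw [cdfFn, ← measureReal_def, ← Iic_union_Ioc_eq_Iic hx.le]
    exact measureReal_union_le _ _
  linarith [real_Iic_zero_of_flatDensity hdens, real_Ioc_zero_le_of_flatDensity hκ hdens hx1]

lemma le_cdfFn_of_flatDensity (hκ : 0 < κ) (hdens : μ = volume.withDensity (flatDensity κ))
    {x : ℝ} (hx : x < 0) (hx1 : -1 ≤ x) : 1 / 2 - κ * Real.exp (1 / x) ≤ cdfFn μ x := by
  have hac : μ ≪ volume := hdens ▸ withDensity_absolutelyContinuous _ _
  have hneg : μ.real (Ioc x 0) = μ.real (Ioc 0 (-x)) := by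
    have h := withDensity_flatDensity_neg κ (measurableSet_Ioc (a := (0 : ℝ)) (b := -x))
    rw [← hdens, Set.neg_Ioc, neg_neg, neg_zero] at h
    rw [measureReal_def, measureReal_def, ← h]
    exact congrArg ENNReal.toReal (measure_congr (hac.ae_eq Ico_ae_eq_Ioc.symm))
  have h : μ.real (Iic 0) ≤ cdfFn μ x + μ.real (Ioc x 0) := by
    rw [cdfFn, ← measureReal_def, ← Iic_union_Ioc_eq_Iic hx.le]
    exact measureReal_union_le _ _
  have hb := real_Ioc_zero_le_of_flatDensity hκ hdens (neg_le.1 hx1)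
  rw [neg_div_neg_eq] at hb
  linarith [real_Iic_zero_of_flatDensity hdens]

lemma cdfFn_one_of_flatDensity (hdens : μ = volume.withDensity (flatDensity κ)) :
    cdfFn μ 1 = 1 := by
  have h := withDensity_flatDensity_Ioi_one κ
  rw [← hdens, ← compl_Iic, prob_compl_eq_zero_iff measurableSet_Iic] at h
  simp [cdfFn, h]

lemma half_le_mul_exp_neg_one_of_flatDensity (hκ : 0 < κ)
    (hdens : μ = volume.withDensity (flatDensity κ)) : 1 / 2 ≤ κ * Real.exp (-1) := by
  have h := cdfFn_le_of_flatDensity hκ hdens one_pos le_rfl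
  rw [cdfFn_one_of_flatDensity hdens, div_one] at h
  linarith

lemma log_div_lt_neg_one_of_flatDensity (hκ : 0 < κ)
    (hdens : μ = volume.withDensity (flatDensity κ)) {v : ℝ} (hv : 0 < v) (hv' : v < 1 / 2) :
    Real.log (v / κ) < -1 := by
  rw [Real.log_lt_iff_lt_exp (by positivity), div_lt_iff₀ hκ, mul_comm]
  exact hv'.trans_le (half_le_mul_exp_neg_one_of_flatDensity hκ hdens)

lemma le_quantileFn_of_flatDensity (hκ : 0 < κ)
    (hdens : μ = volume.withDensity (flatDensity κ)) {u : ℝ} (hu : u ∈ Ioo (1 / 2 : ℝ) 1) :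
    -(1 / Real.log ((u - 1 / 2) / κ)) ≤ quantileFn μ u := by
  have hv : 0 < u - 1 / 2 := sub_pos.2 hu.1
  have hlog := log_div_lt_neg_one_of_flatDensity hκ hdens hv (by linarith [hu.2])
  refine le_csInf ⟨1, (hu.2.le.trans_eq (cdfFn_one_of_flatDensity hdens).symm :)⟩ fun x hx => ?_
  rw [mem_ofPred_eq] at hx
  have hx0 : 0 < x := by
    by_contra! hx0
    have h0 : cdfFn μ 0 = 1 / 2 := real_Iic_zero_of_flatDensity hdens
    linarith [cdfFn_mono (μ := μ) hx0, hu.1]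
  rw [← div_neg, div_le_comm₀ (by linarith) hx0]
  rcases le_total x 1 with hx1 | hx1
  · have hle : (u - 1 / 2) / κ ≤ Real.exp (-1 / x) := by
      rw [div_le_iff₀ hκ, mul_comm]
      linarith [cdfFn_le_of_flatDensity hκ hdens hx0 hx1]
    have := (Real.log_le_iff_le_exp (by positivity)).2 hle
    rw [neg_div] at this
    linarith
  · linarith [(div_le_one hx0).2 hx1]

lemma quantileFn_le_of_flatDensity (hκ : 0 < κ)
    (hdens : μ = volume.withDensity (flatDensity κ)) {u : ℝ} (hu : u ∈ Ioo (0 : ℝ) (1 / 2)) :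
    quantileFn μ u ≤ 1 / Real.log ((1 / 2 - u) / κ) := by
  have hv : 0 < 1 / 2 - u := sub_pos.2 hu.2
  have hlog := log_div_lt_neg_one_of_flatDensity hκ hdens hv (by linarith [hu.1])
  refine csInf_le ⟨-1, fun x hx => ?_⟩ ?_
  · by_contra! hx1
    rw [mem_ofPred_eq, cdfFn_eq_zero_of_flatDensity hdens hx1] at hx
    linarith [hu.1]
  · have hneg : Real.log ((1 / 2 - u) / κ) < 0 := by linarith
    have h := le_cdfFn_of_flatDensity hκ hdens (one_div_neg.2 hneg)
      (by rw [le_div_iff_of_neg hneg]; linarith)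
    rw [one_div_one_div, Real.exp_log (by positivity), mul_div_cancel₀ _ hκ.ne'] at h
    rw [mem_ofPred_eq]
    linarith

end FlatMeasure

/-- Estimates on the cdf and quantile function of the probability measure with
density `ρ(x) = κ e^{−1/|x|}` on `(−1,1)`. -/
theorem cdf_quantile_estimates_for_flat_density
    (κ : ℝ) (hκ : 0 < κ)
    (hnorm : ∫ x in (-1 : ℝ)..1, κ * Real.exp (-1 / |x|) = 1)
    (μ : Measure ℝ) [IsProbabilityMeasure μ]
    (hdens : μ = volume.withDensity (fun x =>
      ENNReal.ofReal (if x ∈ Ioo (-1 : ℝ) 1 then κ * Real.exp (-1 / |x|) else 0))) :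
    (∀ x ∈ Ioo (0 : ℝ) 1, cdfFn μ x ≤ 1 / 2 + κ * Real.exp (-1 / x)) ∧
    (∀ x ∈ Ioo (-1 : ℝ) 0, 1 / 2 - κ * Real.exp (1 / x) ≤ cdfFn μ x) ∧
    (∀ u ∈ Ioo (1 / 2 : ℝ) 1, (u - 1 / 2) / κ < 1 →
      -(1 / Real.log ((u - 1 / 2) / κ)) ≤ quantileFn μ u) ∧
    (∀ u ∈ Ioo (0 : ℝ) (1 / 2), (1 / 2 - u) / κ < 1 →
      quantileFn μ u ≤ 1 / Real.log ((1 / 2 - u) / κ)) := by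
  exact ⟨fun x hx => cdfFn_le_of_flatDensity hκ hdens hx.1 hx.2.le,
    fun x hx => le_cdfFn_of_flatDensity hκ hdens hx.2 hx.1.le,
    fun u hu _ => le_quantileFn_of_flatDensity hκ hdens hu,
    fun u hu _ => quantileFn_le_of_flatDensity hκ hdens hu⟩
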